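/- Let G=(V,E) be a finite simple graph, S ⊆ V a stable (independent) set, and f : S → ℤ≥2. If for every nonempty X ⊆ S we have |Γ*_G(X)| > Σ_{x∈X} f(x) + c_G(X), then G has a forest subgraph F with d_F(v) ≥ f(v) for all v ∈ S. More generally this conclusion holds for arbitrary S ⊆ V under the same strengthened condition. -/

import Mathlib

/-- The closed neighborhood of a finite vertex set `X` in `G`. -/
def closedNbhd {V : Type*} (G : SimpleGraph V) (X : Finset V) : Set V :=
  {v : V | v ∈ X ∨ ∃ x ∈ X, G.Adj x v}

/-- Number of connected components of the subgraph induced by `X`. -/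
noncomputable def numComponents {V : Type*} (G : SimpleGraph V) (X : Finset V) : ℕ :=
  Nat.card (G.induce (X : Set V)).ConnectedComponent

open Function in
/-- A self-map of a finite type admits a choice of one point on each of its eventual cycles. -/
theorem exists_eventual_cycle_representative {V : Type*} [Finite V] (p : V → V) :
    ∃ c : V → V, (∀ x, c (p x) = c x) ∧ ∀ x, ∃ n, p^[n] x = c x := by
  classical
  rcases isEmpty_or_nonempty V with hV | hV
  · exact ⟨id, fun x => hV.elim x, fun x => hV.elim x⟩
  let ω : V → Set V := fun x => {y | ∀ N, ∃ n, N ≤ n ∧ p^[n] x = y}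
  have hω : ∀ x, (ω x).Nonempty := by
    intro x
    obtain ⟨y, hy⟩ := Finite.exists_infinite_fiber (fun n : ℕ => p^[n] x)
    refine ⟨y, fun N => ?_⟩
    obtain ⟨n, hn, hN⟩ := (Set.infinite_coe_iff.1 hy).exists_gt N
    exact ⟨n, hN.le, hn⟩
  have hωp : ∀ x, ω (p x) = ω x := by
    intro x
    ext y
    constructor
    · intro h N
      obtain ⟨n, hn, hy⟩ := h N
      exact ⟨n + 1, by omega, by rwa [iterate_succ_apply]⟩
    · intro h N
      obtain ⟨n, hn, hy⟩ := h (N + 1)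
      obtain ⟨m, rfl⟩ : ∃ m, n = m + 1 := ⟨n - 1, by omega⟩
      exact ⟨m, by omega, by rwa [iterate_succ_apply] at hy⟩
  refine ⟨fun x => Classical.epsilon (fun y => y ∈ ω x), fun x => by simp only [hωp], fun x => ?_⟩
  obtain ⟨n, -, hn⟩ := Classical.epsilon_spec (hω x) 0
  exact ⟨n, hn⟩

/-- A self-map together with representatives of its eventual cycles carries a rank that
decreases along the map away from the representatives. -/
theorem exists_rank_lt_of_ne_representative {V : Type*} (p c : V → V)
    (hc : ∀ x, c (p x) = c x) (hreach : ∀ x, ∃ n, p^[n] x = c x) :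
    ∃ r : V → ℕ, ∀ x, x ≠ c x → r (p x) < r x := by
  classical
  refine ⟨fun x => Nat.find (hreach x), fun x hx => ?_⟩
  have hspec := Nat.find_spec (hreach x)
  cases hn : Nat.find (hreach x) with
  | zero => rw [hn] at hspec; exact absurd hspec hx
  | succ m =>
    rw [hn, Function.iterate_succ_apply] at hspec
    have hle := Nat.find_min' (hreach (p x)) (hspec.trans (hc x).symm)
    simp only [hn]
    omega

/-- A graph is acyclic if every vertex has at most one neighbor that does not exceed it in a
fixed ranking. -/
theorem SimpleGraph.isAcyclic_of_rank {V : Type*} (F : SimpleGraph V) (r : V → ℕ) (p : V → V)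
    (h : ∀ a b, F.Adj a b → r b ≤ r a → b = p a) : F.IsAcyclic := by
  classical
  intro v w hw
  obtain ⟨x, hx, hmax⟩ := w.support.toFinset.exists_max_image r ⟨v, by simp⟩
  rw [List.mem_toFinset] at hx
  have hcyc := hw.rotate hx
  have hle : ∀ y ∈ (w.rotate x hx).support, r y ≤ r x := by
    intro y hy
    exact hmax y (by simpa [SimpleGraph.Walk.mem_support_rotate_iff] using hy)
  have h1 := h _ _ ((w.rotate x hx).adj_snd hcyc.not_nil)
    (hle _ (SimpleGraph.Walk.getVert_mem_support _ _))
  have h2 := h _ _ ((w.rotate x hx).adj_penultimate hcyc.not_nil).symm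
    (hle _ (SimpleGraph.Walk.getVert_mem_support _ _))
  exact hcyc.snd_ne_penultimate (h1.trans h2.symm)

/-- If every vertex chooses a neighbor or itself, then some acyclic subgraph has at every vertex
at least as large a degree as the number of other vertices choosing it. -/
theorem SimpleGraph.exists_isAcyclic_card_fiber_le {V : Type*} [Finite V] (G : SimpleGraph V)
    (p : V → V) (hp : ∀ w, p w ≠ w → G.Adj (p w) w) :
    ∃ F : SimpleGraph V, F ≤ G ∧ F.IsAcyclic ∧
      ∀ v, {w | p w = v ∧ w ≠ v}.ncard ≤ (F.neighborSet v).ncard := by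
  obtain ⟨c, hc, hreach⟩ := exists_eventual_cycle_representative p
  obtain ⟨r, hr⟩ := exists_rank_lt_of_ne_representative p c hc hreach
  refine ⟨SimpleGraph.fromRel (fun a b => a ≠ c a ∧ p a = b), ?_, ?_, ?_⟩
  · intro a b hab
    rw [SimpleGraph.fromRel_adj] at hab
    obtain ⟨hne, ⟨-, rfl⟩ | ⟨-, rfl⟩⟩ := hab
    · exact (hp a hne.symm).symm
    · exact hp b hne
  · refine SimpleGraph.isAcyclic_of_rank _ r p fun a b hab hle => ?_
    rw [SimpleGraph.fromRel_adj] at hab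
    obtain ⟨-, ⟨-, h⟩ | ⟨hb, rfl⟩⟩ := hab
    · exact h.symm
    · exact absurd (hr b hb) (by omega)
  · intro v
    by_cases hall : ∀ w, p w = v → w ≠ v → w ≠ c w
    · refine Set.ncard_le_ncard ?_ (Set.toFinite _)
      rintro w ⟨hw, hwv⟩
      rw [SimpleGraph.mem_neighborSet, SimpleGraph.fromRel_adj]
      exact ⟨hwv.symm, Or.inr ⟨hall w hw hwv, hw⟩⟩
    · push Not at hall
      obtain ⟨w₀, hw₀, hne, hrep⟩ := hall
      have hcv : c v = w₀ := by rw [← hw₀, hc, ← hrep]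
      have hv : v ≠ c v := by rw [hcv]; exact hne.symm
      have hpv : p v ∉ {w | p w = v ∧ w ≠ v} \ {w₀} := by
        rintro ⟨⟨hpp, -⟩, hpw⟩
        have h1 := hr v hv
        have h2 := hr (p v) (by rw [hc, hcv]; exact hpw)
        rw [hpp] at h2
        omega
      have hcard : (insert (p v) ({w | p w = v ∧ w ≠ v} \ {w₀})).ncard =
          {w | p w = v ∧ w ≠ v}.ncard := by
        rw [Set.ncard_insert_of_notMem hpv (Set.toFinite _)]
        exact Set.ncard_sdiff_singleton_add_one ⟨hw₀, hne⟩ (Set.toFinite _)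
      rw [← hcard]
      refine Set.ncard_le_ncard ?_ (Set.toFinite _)
      intro w hw
      rw [SimpleGraph.mem_neighborSet, SimpleGraph.fromRel_adj]
      rcases hw with rfl | ⟨⟨hw, hwv⟩, hw0⟩
      · refine ⟨fun h => ?_, Or.inl ⟨hv, rfl⟩⟩
        have := hr v hv
        rw [← h] at this
        omega
      · refine ⟨hwv.symm, Or.inr ⟨fun h => hw0 ?_, hw⟩⟩
        rw [Set.mem_singleton_iff, h, ← hcv, ← hw, hc]

/-- The closed neighborhood of `X` exceeds the open one by at most the number of components of
`G[X]`. -/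
theorem card_closedNbhd_le {V : Type*} [Finite V] (G : SimpleGraph V) (X : Finset V) :
    Nat.card (closedNbhd G X) ≤ {v | ∃ x ∈ X, G.Adj x v}.ncard + numComponents G X := by
  have hsub : closedNbhd G X ⊆
      {v | ∃ x ∈ X, G.Adj x v} ∪ {v | v ∈ X ∧ ∀ x ∈ X, ¬ G.Adj x v} := by
    intro v hv
    by_cases h : ∃ x ∈ X, G.Adj x v
    · exact Or.inl h
    · push Not at h
      exact Or.inr ⟨hv.resolve_right (by push Not; exact h), h⟩
  have hisolated : {v | v ∈ X ∧ ∀ x ∈ X, ¬ G.Adj x v}.ncard ≤ numComponents G X := by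
    rw [← Nat.card_coe_set_eq, numComponents]
    refine Nat.card_le_card_of_injective
      (fun v => (G.induce (X : Set V)).connectedComponentMk ⟨v.1, v.2.1⟩) ?_
    rintro ⟨a, haX, ha⟩ ⟨b, hbX, hb⟩ hab
    obtain ⟨w⟩ := SimpleGraph.ConnectedComponent.exact hab
    cases w with
    | nil => rfl
    | cons hadj _ => exact absurd (SimpleGraph.comap_adj.1 hadj).symm (ha _ (Subtype.prop _))
  calc Nat.card (closedNbhd G X) = (closedNbhd G X).ncard := Nat.card_coe_set_eq _
    _ ≤ _ := Set.ncard_le_ncard hsub (Set.toFinite _)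
    _ ≤ _ := Set.ncard_union_le _ _
    _ ≤ _ := by gcongr

/-- Hall's theorem with demands: if every `X ⊆ S` has at least `∑ x ∈ X, f x` neighbors, then
each `v ∈ S` can be given `f v` private neighbors. -/
theorem SimpleGraph.exists_private_neighbors {V : Type*} [Finite V] (G : SimpleGraph V)
    (S : Finset V) (f : V → ℕ)
    (h : ∀ X ⊆ S, ∑ x ∈ X, f x ≤ {v | ∃ x ∈ X, G.Adj x v}.ncard) :
    ∃ p : V → V, (∀ w, p w ≠ w → G.Adj (p w) w) ∧
      ∀ v ∈ S, f v ≤ {w | p w = v ∧ w ≠ v}.ncard := by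
  classical
  have := Fintype.ofFinite V
  obtain ⟨φ, hinj, hφ⟩ := (Finset.all_card_le_biUnion_card_iff_exists_injective
    (fun a : (Σ v : S, Fin (f v)) => G.neighborFinset a.1)).1 (by
      intro A
      let X : Finset S := A.image Sigma.fst
      calc A.card ≤ (X.sigma fun v => (Finset.univ : Finset (Fin (f v)))).card := by
            refine Finset.card_le_card fun a ha => ?_
            simpa [X] using ⟨a.2, ha⟩
        _ = ∑ v ∈ X.map (Function.Embedding.subtype _), f v := by simp
        _ ≤ _ := h _ (by intro v hv; simp at hv; exact hv.1)
        _ = _ := by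
            rw [← Set.ncard_coe_finset]
            congr 1
            ext v
            simp [X])
  have hadj : ∀ a, G.Adj a.1 (φ a) := fun a => by simpa using hφ a
  have hext : ∀ a, Function.extend φ (fun a => (a.1 : V)) id (φ a) = a.1 :=
    fun a => hinj.extend_apply _ _ a
  refine ⟨Function.extend φ (fun a => (a.1 : V)) id, fun w hw => ?_, fun v hv => ?_⟩
  · by_cases hex : ∃ a, φ a = w
    · obtain ⟨a, rfl⟩ := hex
      rw [hext]
      exact hadj a
    · exact absurd (Function.extend_apply' _ _ _ hex) hw
  · rw [← Nat.card_coe_set_eq, ← Nat.card_fin (f v)]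
    refine Nat.card_le_card_of_injective
      (fun i => ⟨φ ⟨⟨v, hv⟩, i⟩, hext _, (hadj ⟨⟨v, hv⟩, i⟩).ne'⟩) ?_
    intro i j hij
    simpa using hinj (Subtype.mk.inj hij)

/-- Singh–Lau sufficient condition (for arbitrary `S ⊆ V`, in particular for
stable `S`): if `|Γ*_G(X)| > f(X) + c_G(X)` for every nonempty `X ⊆ S`, then
`G` has a forest subgraph `F` with `d_F(v) ≥ f(v)` for all `v ∈ S`. -/
theorem singh_lau_forest
    {V : Type*} [Fintype V] (G : SimpleGraph V) (S : Finset V) (f : V → ℤ)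
    (hf : ∀ v ∈ S, 2 ≤ f v)
    (hcond : ∀ X : Finset V, X ⊆ S → X.Nonempty →
      (∑ x ∈ X, f x) + (numComponents G X : ℤ) <
        (Nat.card (closedNbhd G X) : ℤ)) :
    ∃ F : SimpleGraph V, F ≤ G ∧ F.IsAcyclic ∧
      ∀ v ∈ S, f v ≤ (Nat.card (F.neighborSet v) : ℤ) := by
  obtain ⟨p, hp, hdeg⟩ := G.exists_private_neighbors S (fun v => (f v).toNat) (by
    intro X hX
    rcases X.eq_empty_or_nonempty with rfl | hne
    · simp
    have h1 := hcond X hX hne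
    have h2 := card_closedNbhd_le G X
    have h3 : ((∑ x ∈ X, (f x).toNat : ℕ) : ℤ) = ∑ x ∈ X, f x := by
      rw [Nat.cast_sum]
      exact Finset.sum_congr rfl fun x hx => Int.toNat_of_nonneg (by linarith [hf x (hX hx)])
    omega)
  obtain ⟨F, hFG, hF, hcard⟩ := G.exists_isAcyclic_card_fiber_le p hp
  refine ⟨F, hFG, hF, fun v hv => ?_⟩
  have h1 := hdeg v hv
  have h2 := hcard v
  rw [Nat.card_coe_set_eq]
  omega
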